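/- Let x₀ ∈ ℝ^n, let Ω ∈ L_s(S^{n−1}) with 1 < s ≤ ∞ be homogeneous of degree zero, have mean zero on S^{n−1}, and satisfy |Ω(x′) − Ω(y′)| ≤ M |x′ − y′|^γ on S^{n−1} for some 0 < γ ≤ 1. Let 0 < α < n, 1 < p < n/α, 1/q = 1/p − α/n, and assume either s′ = s/(s−1) ≤ p and the pair (φ₁, φ₂) satisfies ∫_r^∞ (essinf_{t<τ<∞} φ₁(x₀,τ) τ^{n/p}) t^{−n/q−1} dt ≤ C φ₂(x₀,r), or q < s and ∫_r^∞ (essinf_{t<τ<∞} φ₁(x₀,τ) τ^{n/p}) t^{n/s − n/q − 1} dt ≤ C φ₂(x₀,r) r^{n/s}, with C independent of r. Then the Marcinkiewicz operator μ_{Ω,α} is bounded from the generalized local Morrey space LM_{p,φ₁}^{{x₀}} to LM_{q,φ₂}^{{x₀}}: ‖μ_{Ω,α}f‖_{LM_{q,φ₂}^{{x₀}}} ≤ C′ ‖f‖_{LM_{p,φ₁}^{{x₀}}}. -/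

import Mathlib

open MeasureTheory Metric Set ENNReal NNReal Topology Filter

noncomputable section

/-- `Ω` is homogeneous of degree zero on `ℝⁿ`. -/
def HomogZero {n : ℕ} (Ω : EuclideanSpace ℝ (Fin n) → ℝ) : Prop :=
  ∀ c : ℝ, 0 < c → ∀ x : EuclideanSpace ℝ (Fin n), x ≠ 0 → Ω (c • x) = Ω x

/-- The restriction of `Ω` to the unit sphere belongs to `L_s(S^{n-1})`. -/
def MemLsSphere {n : ℕ} (Ω : EuclideanSpace ℝ (Fin n) → ℝ) (s : ℝ≥0∞) : Prop :=
  eLpNorm (fun z : sphere (0 : EuclideanSpace ℝ (Fin n)) 1 => Ω (z : EuclideanSpace ℝ (Fin n))) s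
    ((volume : Measure (EuclideanSpace ℝ (Fin n))).toSphere) < ∞

/-- The size condition (e1). -/
def SizeCond {n : ℕ} (Ω : EuclideanSpace ℝ (Fin n) → ℝ) (α : ℝ)
    (T : (EuclideanSpace ℝ (Fin n) → ℝ) → EuclideanSpace ℝ (Fin n) → ℝ) (c₀ : ℝ) : Prop :=
  ∀ f : EuclideanSpace ℝ (Fin n) → ℝ, Integrable f volume → HasCompactSupport f →
    ∀ x ∉ tsupport f,
      ENNReal.ofReal |T f x| ≤ ENNReal.ofReal c₀ *
        ∫⁻ y, ENNReal.ofReal (|Ω (x - y)| * |f y|) / ENNReal.ofReal (‖x - y‖ ^ ((n : ℝ) - α))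

/-- `T` is a sublinear operator. -/
def SublinearOp {n : ℕ}
    (T : (EuclideanSpace ℝ (Fin n) → ℝ) → EuclideanSpace ℝ (Fin n) → ℝ) : Prop :=
  (∀ f g x, |T (f + g) x| ≤ |T f x| + |T g x|) ∧ ∀ (c : ℝ) (f) (x), |T (c • f) x| = |c| * |T f x|

/-- The `L_p` norm of `f` over the ball `B(x₀, r)`. -/
def LpB {n : ℕ} (p : ℝ) (f : EuclideanSpace ℝ (Fin n) → ℝ) (x₀ : EuclideanSpace ℝ (Fin n))
    (r : ℝ) : ℝ≥0∞ :=
  eLpNorm f (ENNReal.ofReal p) (volume.restrict (ball x₀ r))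

/-- The weak `L_q` norm of `f` with respect to `μ`. -/
def WLp {n : ℕ} (q : ℝ) (f : EuclideanSpace ℝ (Fin n) → ℝ)
    (μ : Measure (EuclideanSpace ℝ (Fin n))) : ℝ≥0∞ :=
  ⨆ t : ℝ≥0, (t : ℝ≥0∞) * (μ {y | (t : ℝ) < |f y|}) ^ (1 / q)

/-- The generalized local Morrey norm `‖f‖_{LM_{p,φ}^{x₀}}`. -/
def LMnorm {n : ℕ} (p : ℝ) (φ : EuclideanSpace ℝ (Fin n) → ℝ → ℝ)
    (x₀ : EuclideanSpace ℝ (Fin n)) (f : EuclideanSpace ℝ (Fin n) → ℝ) : ℝ≥0∞ :=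
  ⨆ r : {r : ℝ // 0 < r},
    (ENNReal.ofReal (φ x₀ r))⁻¹ * (volume (ball x₀ (r : ℝ))) ^ (-(1 / p)) * LpB p f x₀ r

/-- The weak generalized local Morrey norm. -/
def WLMnorm {n : ℕ} (p : ℝ) (φ : EuclideanSpace ℝ (Fin n) → ℝ → ℝ)
    (x₀ : EuclideanSpace ℝ (Fin n)) (f : EuclideanSpace ℝ (Fin n) → ℝ) : ℝ≥0∞ :=
  ⨆ r : {r : ℝ // 0 < r},
    (ENNReal.ofReal (φ x₀ r))⁻¹ * (volume (ball x₀ (r : ℝ))) ^ (-(1 / p)) *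
      WLp p f (volume.restrict (ball x₀ (r : ℝ)))

/-- The local Campanato norm `‖b‖_{LC_{p,λ}^{x₀}}`. -/
def LCnorm {n : ℕ} (p lam : ℝ) (x₀ : EuclideanSpace ℝ (Fin n))
    (b : EuclideanSpace ℝ (Fin n) → ℝ) : ℝ≥0∞ :=
  ⨆ r : {r : ℝ // 0 < r},
    ((volume (ball x₀ (r : ℝ))) ^ (-(1 + lam * p)) *
      ∫⁻ y in ball x₀ (r : ℝ),
        ENNReal.ofReal (|b y - ⨍ z in ball x₀ (r : ℝ), b z| ^ p)) ^ (1 / p)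

/-- `b` belongs to the local Campanato space `LC_{p,λ}^{x₀}(ℝⁿ)`. -/
def MemLC {n : ℕ} (p lam : ℝ) (x₀ : EuclideanSpace ℝ (Fin n))
    (b : EuclideanSpace ℝ (Fin n) → ℝ) : Prop :=
  AEStronglyMeasurable b volume ∧ (∀ (x : EuclideanSpace ℝ (Fin n)) (r : ℝ), 0 < r → LpB p b x r < ∞) ∧
    LCnorm p lam x₀ b < ∞

/-- `F_{Ω,α,t}(f)(x) = ∫_{|x-y| ≤ t} Ω(x-y) f(y) / |x-y|^{n-1-α} dy`. -/
def FMarc {n : ℕ} (Ω f : EuclideanSpace ℝ (Fin n) → ℝ) (α t : ℝ)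
    (x : EuclideanSpace ℝ (Fin n)) : ℝ :=
  ∫ y in closedBall x t, Ω (x - y) * f y / ‖x - y‖ ^ ((n : ℝ) - 1 - α)

/-- The Marcinkiewicz operator of order `α`,
`μ_{Ω,α}(f)(x) = (∫_0^∞ |F_{Ω,α,t}(f)(x)|² dt/t³)^{1/2}`. -/
def marcinkiewicz {n : ℕ} (Ω f : EuclideanSpace ℝ (Fin n) → ℝ) (α : ℝ)
    (x : EuclideanSpace ℝ (Fin n)) : ℝ≥0∞ :=
  (∫⁻ t in Ioi (0 : ℝ), ENNReal.ofReal ((FMarc Ω f α t x) ^ 2 / t ^ 3)) ^ ((1 : ℝ) / 2)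

/-- The `L_p(B(x₀,r))` quasinorm of an `ℝ≥0∞`-valued function. -/
def LpBE {n : ℕ} (p : ℝ) (g : EuclideanSpace ℝ (Fin n) → ℝ≥0∞)
    (x₀ : EuclideanSpace ℝ (Fin n)) (r : ℝ) : ℝ≥0∞ :=
  (∫⁻ y in ball x₀ r, g y ^ p) ^ (1 / p)

/-- The generalized local Morrey norm of an `ℝ≥0∞`-valued function. -/
def LMnormE {n : ℕ} (p : ℝ) (φ : EuclideanSpace ℝ (Fin n) → ℝ → ℝ)
    (x₀ : EuclideanSpace ℝ (Fin n)) (g : EuclideanSpace ℝ (Fin n) → ℝ≥0∞) : ℝ≥0∞ :=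
  ⨆ r : {r : ℝ // 0 < r},
    (ENNReal.ofReal (φ x₀ r))⁻¹ * (volume (ball x₀ (r : ℝ))) ^ (-(1 / p)) *
      LpBE p g x₀ r

section PowerIntegrals

theorem lintegral_Ioo_rpow_sub_one {a R : ℝ} (ha : 0 < a) (hR : 0 ≤ R) :
    ∫⁻ t in Ioo 0 R, ENNReal.ofReal (t ^ (a - 1)) = ENNReal.ofReal (R ^ a / a) := by
  have hint : IntegrableOn (fun t : ℝ => t ^ (a - 1)) (Ioc 0 R) :=
    (intervalIntegrable_iff_integrableOn_Ioc_of_le hR).1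
      (intervalIntegral.intervalIntegrable_rpow' (by linarith))
  rw [setLIntegral_congr Ioo_ae_eq_Ioc, ← ofReal_integral_eq_lintegral_ofReal hint,
    ← intervalIntegral.integral_of_le hR, integral_rpow (Or.inl (by linarith))]
  · simp [Real.zero_rpow ha.ne']
  · filter_upwards [ae_restrict_mem measurableSet_Ioc] with t ht
    exact Real.rpow_nonneg ht.1.le _

theorem lintegral_Ioi_rpow_neg_sub_one {a R : ℝ} (ha : 0 < a) (hR : 0 < R) :
    ∫⁻ t in Ioi R, ENNReal.ofReal (t ^ (-a - 1)) = ENNReal.ofReal (R ^ (-a) / a) := by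
  rw [← ofReal_integral_eq_lintegral_ofReal (integrableOn_Ioi_rpow_of_lt (by linarith) hR),
    integral_Ioi_rpow_of_lt (by linarith) hR]
  · congr 1
    rw [sub_add_cancel, neg_div_neg_eq]
  · filter_upwards [ae_restrict_mem measurableSet_Ioi] with t ht
    exact Real.rpow_nonneg (hR.trans ht).le _

theorem lintegral_rpow_sub_one_ofReal_lt {a : ℝ} (ha : 0 < a) (b : ℝ≥0∞) :
    ∫⁻ t in {t : ℝ | ENNReal.ofReal t < b}, ENNReal.ofReal (t ^ (a - 1)) ∂volume.restrict (Ioi 0) =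
      b ^ a / ENNReal.ofReal a := by
  rw [Measure.restrict_restrict (measurableSet_lt ENNReal.measurable_ofReal measurable_const)]
  rcases eq_or_ne b ⊤ with rfl | hb
  · rw [ENNReal.top_rpow_of_pos ha, ENNReal.top_div_of_ne_top ofReal_ne_top]
    refine ENNReal.eq_top_of_forall_nnreal_le fun r => ?_
    have hr : (0 : ℝ) ≤ (a * r) ^ a⁻¹ := by positivity
    calc (r : ℝ≥0∞) = ENNReal.ofReal (((a * r) ^ a⁻¹) ^ a / a) := by
          rw [← Real.rpow_mul (by positivity), inv_mul_cancel₀ ha.ne', Real.rpow_one,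
            mul_div_cancel_left₀ _ ha.ne', ofReal_coe_nnreal]
      _ = ∫⁻ t in Ioo 0 ((a * r) ^ a⁻¹), ENNReal.ofReal (t ^ (a - 1)) :=
          (lintegral_Ioo_rpow_sub_one ha hr).symm
      _ ≤ _ := lintegral_mono_set (t := _ ∩ _) fun t ht => ⟨ofReal_lt_top, ht.1⟩
  · have hset : {t : ℝ | ENNReal.ofReal t < b} ∩ Ioi 0 = Ioo 0 b.toReal := by
      ext t
      simp only [mem_inter_iff, mem_ofPred_eq, mem_Ioi, mem_Ioo, and_comm (a := 0 < t)]
      refine and_congr_left fun ht => ?_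
      rw [ENNReal.ofReal_lt_iff_lt_toReal ht.le hb]
    rw [hset, lintegral_Ioo_rpow_sub_one ha toReal_nonneg, ENNReal.ofReal_div_of_pos ha,
      ← ENNReal.ofReal_rpow_of_nonneg toReal_nonneg ha.le, ENNReal.ofReal_toReal hb]

end PowerIntegrals

section Swap

variable {X Y : Type*} [MeasurableSpace X] [MeasurableSpace Y]

/-- Tonelli's theorem for a product function restricted to a measurable set. -/
theorem lintegral_mul_setLIntegral_swap {μ : Measure X} {ν : Measure Y} [SFinite μ] [SFinite ν]
    {S : Set (X × Y)} (hS : MeasurableSet S) {ψ : X → ℝ≥0∞} {h : Y → ℝ≥0∞} (hψ : Measurable ψ)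
    (hh : Measurable h) :
    ∫⁻ a, ψ a * ∫⁻ b in {b | (a, b) ∈ S}, h b ∂ν ∂μ =
      ∫⁻ b, h b * ∫⁻ a in {a | (a, b) ∈ S}, ψ a ∂μ ∂ν := by
  have h1 (a : X) : ψ a * ∫⁻ b in {b | (a, b) ∈ S}, h b ∂ν =
      ∫⁻ b, S.indicator (fun z => ψ z.1 * h z.2) (a, b) ∂ν := by
    have hSa : MeasurableSet {b | (a, b) ∈ S} := measurable_prodMk_left hS
    rw [← lintegral_const_mul _ hh, ← lintegral_indicator hSa]
    rfl
  have h2 (b : Y) : h b * ∫⁻ a in {a | (a, b) ∈ S}, ψ a ∂μ =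
      ∫⁻ a, S.indicator (fun z => ψ z.1 * h z.2) (a, b) ∂μ := by
    have hSb : MeasurableSet {a | (a, b) ∈ S} := measurable_prodMk_right hS
    rw [← lintegral_const_mul _ hψ, ← lintegral_indicator hSb]
    simp_rw [mul_comm (h b)]
    rfl
  simp_rw [h1, h2]
  exact lintegral_lintegral_swap
    (((hψ.comp measurable_fst).mul (hh.comp measurable_snd)).indicator hS).aemeasurable

/-- The layer-cake formula for `ℝ≥0∞`-valued functions. -/
theorem lintegral_rpow_eq_lintegral_measure_ofReal_lt {ν : Measure Y} [SFinite ν] {h : Y → ℝ≥0∞}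
    (hh : Measurable h) {p : ℝ} (hp : 0 < p) :
    ∫⁻ y, h y ^ p ∂ν = ENNReal.ofReal p *
      ∫⁻ t in Ioi 0, ENNReal.ofReal (t ^ (p - 1)) * ν {y | ENNReal.ofReal t < h y} := by
  have hS : MeasurableSet {z : ℝ × Y | ENNReal.ofReal z.1 < h z.2} :=
    measurableSet_lt (by fun_prop) (by fun_prop)
  have key := lintegral_mul_setLIntegral_swap (μ := volume.restrict (Ioi (0 : ℝ))) (ν := ν) hS
    (ψ := fun t => ENNReal.ofReal (t ^ (p - 1))) (h := fun _ => 1) (by fun_prop) measurable_const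
  simp only [setLIntegral_one, mem_ofPred_eq, one_mul] at key
  simp_rw [key, lintegral_rpow_sub_one_ofReal_lt hp, div_eq_mul_inv]
  rw [lintegral_mul_const _ (by fun_prop), mul_left_comm, ENNReal.mul_inv_cancel (by simpa)
    ofReal_ne_top, mul_one]

/-- Hölder's inequality against the indicator function of a set. -/
theorem setLIntegral_le_rpow_mul_measure_rpow {ν : Measure Y} {h : Y → ℝ≥0∞} (hh : Measurable h)
    {p : ℝ} (hp : 1 < p) (A : Set Y) :
    ∫⁻ y in A, h y ∂ν ≤ (∫⁻ y in A, h y ^ p ∂ν) ^ (1 / p) * ν A ^ (1 - 1 / p) := by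
  have hpq := Real.HolderConjugate.conjExponent hp
  have key := ENNReal.lintegral_mul_le_Lp_mul_Lq (ν.restrict A) hpq hh.aemeasurable
    (g := fun _ => 1) aemeasurable_const
  simp only [Pi.mul_apply, mul_one, ENNReal.one_rpow, lintegral_const, Measure.restrict_apply_univ,
    one_mul] at key
  rwa [one_div (p.conjExponent), ← hpq.one_sub_inv, ← one_div p] at key

end Swap

section Maximal

open Module

variable {E : Type*} [NormedAddCommGroup E] [NormedSpace ℝ E] [FiniteDimensional ℝ E]
  [MeasurableSpace E] (μ : Measure E) [μ.IsAddHaarMeasure]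

/-- The centred Hardy–Littlewood maximal function over balls of rational radius. -/
def maximalFunction (g : E → ℝ≥0∞) (x : E) : ℝ≥0∞ :=
  ⨆ s : {s : ℚ // 0 < s}, (∫⁻ y in closedBall x (s : ℚ), g y ∂μ) / μ (closedBall x (s : ℚ))

theorem setLIntegral_closedBall_le_maximalFunction (g : E → ℝ≥0∞) (x : E) {r t : ℝ} (hr : 0 ≤ r)
    (hrt : r < t) :
    ∫⁻ y in closedBall x r, g y ∂μ ≤ maximalFunction μ g x * μ (closedBall x t) := by
  obtain ⟨s, hrs, hst⟩ := exists_rat_btwn hrt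
  have hs : 0 < s := by exact_mod_cast hr.trans_lt hrs
  have hs' : (0 : ℝ) < s := by exact_mod_cast hs
  have h1 : (∫⁻ y in closedBall x s, g y ∂μ) / μ (closedBall x s) ≤ maximalFunction μ g x :=
    le_iSup (fun s : {s : ℚ // 0 < s} =>
      (∫⁻ y in closedBall x (s : ℚ), g y ∂μ) / μ (closedBall x (s : ℚ))) ⟨s, hs⟩
  rw [ENNReal.div_le_iff (measure_closedBall_pos μ x hs').ne' measure_closedBall_lt_top.ne] at h1
  calc ∫⁻ y in closedBall x r, g y ∂μ ≤ ∫⁻ y in closedBall x s, g y ∂μ :=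
        lintegral_mono_set (closedBall_subset_closedBall hrs.le)
    _ ≤ _ := h1
    _ ≤ _ := by gcongr

variable [BorelSpace E]

theorem measurable_setLIntegral_closedBall {g : E → ℝ≥0∞} (hg : Measurable g) (r : ℝ) :
    Measurable fun x => ∫⁻ y in closedBall x r, g y ∂μ := by
  have hS : MeasurableSet {z : E × E | dist z.2 z.1 ≤ r} :=
    measurableSet_le (by fun_prop) measurable_const
  have : (fun x => ∫⁻ y in closedBall x r, g y ∂μ) =
      fun x => ∫⁻ y, {z : E × E | dist z.2 z.1 ≤ r}.indicator (fun z => g z.2) (x, y) ∂μ := by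
    ext x
    rw [← lintegral_indicator measurableSet_closedBall]
    rfl
  rw [this]
  exact ((hg.comp measurable_snd).indicator hS).lintegral_prod_right'

theorem measurable_maximalFunction {g : E → ℝ≥0∞} (hg : Measurable g) :
    Measurable (maximalFunction μ g) := by
  refine Measurable.iSup fun s => (measurable_setLIntegral_closedBall μ hg _).div ?_
  simp_rw [μ.addHaar_closedBall_center]
  exact measurable_const

/-- The weak-type `(1, 1)` estimate for the maximal function. -/
theorem mul_measure_lt_maximalFunction_le [Nontrivial E] (g : E → ℝ≥0∞) (c : ℝ≥0∞) :
    c * μ {x | c < maximalFunction μ g x} ≤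
      ENNReal.ofReal (4 ^ finrank ℝ E) * ∫⁻ y, g y ∂μ := by
  have h4 : ENNReal.ofReal (4 ^ finrank ℝ E) ≠ 0 := by simp
  rcases eq_or_ne c 0 with rfl | hc
  · simp
  rcases eq_or_ne c ⊤ with rfl | hc'
  · simp
  rcases eq_or_ne (∫⁻ y, g y ∂μ) ⊤ with hg | hg
  · rw [hg, ENNReal.mul_top h4]
    exact le_top
  set S := {x | c < maximalFunction μ g x}
  have hex (x : E) : ∃ s : ℝ, 0 < s ∧
      (x ∈ S → c * μ (closedBall x s) ≤ ∫⁻ y in closedBall x s, g y ∂μ) := by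
    by_cases hx : x ∈ S
    · obtain ⟨⟨s, hs⟩, hs'⟩ := lt_iSup_iff.1 (show c < ⨆ _, _ from hx)
      have hs0 : (0 : ℝ) < s := by exact_mod_cast hs
      refine ⟨s, hs0, fun _ => ?_⟩
      rw [← ENNReal.le_div_iff_mul_le (Or.inl (measure_closedBall_pos μ x hs0).ne')
        (Or.inl measure_closedBall_lt_top.ne)]
      exact hs'.le
    · exact ⟨1, one_pos, fun h => absurd h hx⟩
  choose ρ hρ hρS using hex
  set V : ℝ≥0∞ := (∫⁻ y, g y ∂μ) / c / μ (ball 0 1)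
  have hV : V ≠ ⊤ :=
    ENNReal.div_ne_top (ENNReal.div_ne_top hg hc) (measure_ball_pos μ 0 one_pos).ne'
  have hρV (x : E) (hx : x ∈ S) : ρ x ≤ max 1 V.toReal := by
    by_contra! hlt
    have h1 : 1 ≤ ρ x := (le_max_left _ _).trans hlt.le
    refine ((le_max_right _ _).trans_lt hlt).not_ge ?_
    have h2 : ENNReal.ofReal (ρ x ^ finrank ℝ E) ≤ V := by
      rw [ENNReal.le_div_iff_mul_le (Or.inl (measure_ball_pos μ 0 one_pos).ne')
        (Or.inl measure_ball_lt_top.ne), ENNReal.le_div_iff_mul_le (Or.inl hc) (Or.inl hc'),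
        ← μ.addHaar_closedBall x (hρ x).le, mul_comm]
      exact (hρS x hx).trans (setLIntegral_le_lintegral _ _)
    calc ρ x ≤ ρ x ^ finrank ℝ E := le_self_pow₀ h1 finrank_pos.ne'
      _ ≤ V.toReal := (ENNReal.ofReal_le_iff_le_toReal hV).1 h2
  obtain ⟨u, huS, hdisj, hcov⟩ := Vitali.exists_disjoint_subfamily_covering_enlargement_closedBall
    S (fun x => x) ρ _ hρV 4 (by norm_num)
  have hu : u.Countable := hdisj.countable_of_nonempty_interior fun x _ =>
    ⟨x, ball_subset_interior_closedBall (mem_ball_self (hρ x))⟩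
  have hSu : S ⊆ ⋃ b ∈ u, closedBall b (4 * ρ b) := fun x hx => by
    obtain ⟨b, hb, hsub⟩ := hcov x hx
    exact mem_iUnion₂.2 ⟨b, hb, hsub (mem_closedBall_self (hρ x).le)⟩
  have hball (b : E) : μ (closedBall b (4 * ρ b)) =
      ENNReal.ofReal (4 ^ finrank ℝ E) * μ (closedBall b (ρ b)) := by
    rw [μ.addHaar_closedBall_mul b (by norm_num) (hρ b).le, μ.addHaar_closedBall_center b]
  calc c * μ S ≤ c * ∑' b : u, μ (closedBall b (4 * ρ b)) := by
        gcongr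
        exact (measure_mono hSu).trans (measure_biUnion_le μ hu _)
    _ = ENNReal.ofReal (4 ^ finrank ℝ E) * ∑' b : u, c * μ (closedBall b (ρ b)) := by
        simp_rw [hball, ENNReal.tsum_mul_left]
        ring
    _ ≤ ENNReal.ofReal (4 ^ finrank ℝ E) * ∑' b : u, ∫⁻ y in closedBall b (ρ b), g y ∂μ := by
        gcongr with b
        exact hρS b (huS b.2)
    _ = ENNReal.ofReal (4 ^ finrank ℝ E) * ∫⁻ y in ⋃ b ∈ u, closedBall b (ρ b), g y ∂μ := by
        rw [lintegral_biUnion hu (fun _ _ => measurableSet_closedBall) hdisj]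
    _ ≤ _ := by
        gcongr
        exact Measure.restrict_le_self

/-- Truncating at height `c / 2` sharpens the weak-type estimate. -/
theorem mul_measure_lt_maximalFunction_le_setLIntegral [Nontrivial E] {g : E → ℝ≥0∞}
    (hg : Measurable g) (c : ℝ≥0∞) :
    c * μ {x | c < maximalFunction μ g x} ≤
      2 * ENNReal.ofReal (4 ^ finrank ℝ E) * ∫⁻ y in {y | c < 2 * g y}, g y ∂μ := by
  set A := {y | c < 2 * g y}
  have hA : MeasurableSet A := measurableSet_lt measurable_const (by fun_prop)
  have hle (x : E) : maximalFunction μ g x ≤ maximalFunction μ (A.indicator g) x + c / 2 := by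
    refine iSup_le fun s => ?_
    have hs : (0 : ℝ) < (s : ℚ) := by exact_mod_cast s.2
    have hB := (measure_closedBall_pos μ x hs).ne'
    have hB' : μ (closedBall x (s : ℚ)) ≠ ⊤ := measure_closedBall_lt_top.ne
    have h1 : ∫⁻ y in closedBall x (s : ℚ), g y ∂μ ≤
        (∫⁻ y in closedBall x (s : ℚ), A.indicator g y ∂μ) +
          c / 2 * μ (closedBall x (s : ℚ)) := by
      rw [← setLIntegral_const, ← lintegral_add_right _ measurable_const]
      refine lintegral_mono fun y => ?_
      by_cases hy : y ∈ A
      · simp [hy]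
      · simp only [hy, not_false_eq_true, indicator_of_notMem, zero_add]
        rw [ENNReal.le_div_iff_mul_le (by simp) (by simp), mul_comm]
        exact not_lt.1 hy
    calc _ ≤ ((∫⁻ y in closedBall x (s : ℚ), A.indicator g y ∂μ) +
          c / 2 * μ (closedBall x (s : ℚ))) / μ (closedBall x (s : ℚ)) := by gcongr
      _ = (∫⁻ y in closedBall x (s : ℚ), A.indicator g y ∂μ) / μ (closedBall x (s : ℚ)) +
          c / 2 := by rw [ENNReal.add_div, ENNReal.mul_div_cancel_right hB hB']
      _ ≤ _ := by
        gcongr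
        exact le_iSup (fun s : {s : ℚ // 0 < s} => (∫⁻ y in closedBall x (s : ℚ),
          A.indicator g y ∂μ) / μ (closedBall x (s : ℚ))) s
  have hsub : {x | c < maximalFunction μ g x} ⊆
      {x | c / 2 < maximalFunction μ (A.indicator g) x} := fun x hx => by
    by_contra hx'
    have h2 := (hle x).trans (add_le_add_left (not_lt.1 hx') _)
    rw [ENNReal.add_halves] at h2
    exact h2.not_gt hx
  calc c * μ {x | c < maximalFunction μ g x}
      ≤ 2 * (c / 2) * μ {x | c / 2 < maximalFunction μ (A.indicator g) x} := by
        rw [ENNReal.mul_div_cancel (by simp) (by simp)]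
        gcongr
    _ ≤ 2 * (ENNReal.ofReal (4 ^ finrank ℝ E) * ∫⁻ y, A.indicator g y ∂μ) := by
        rw [mul_assoc]
        exact mul_le_mul_right (mul_measure_lt_maximalFunction_le μ _ _) _
    _ = _ := by rw [lintegral_indicator hA, mul_assoc]

/-- The Hardy–Littlewood maximal theorem in `L_p`. -/
theorem exists_lintegral_maximalFunction_rpow_le [Nontrivial E] {p : ℝ} (hp : 1 < p) :
    ∃ C : ℝ≥0∞, C ≠ ⊤ ∧ ∀ g : E → ℝ≥0∞, Measurable g →
      ∫⁻ x, maximalFunction μ g x ^ p ∂μ ≤ C * ∫⁻ x, g x ^ p ∂μ := by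
  set D : ℝ≥0∞ := 2 * ENNReal.ofReal (4 ^ finrank ℝ E)
  have hp1 : 0 < p - 1 := by linarith
  refine ⟨ENNReal.ofReal p * (D * (2 ^ (p - 1) / ENNReal.ofReal (p - 1))), ?_, fun g hg => ?_⟩
  · have : ENNReal.ofReal (p - 1) ≠ 0 := by simpa using hp
    finiteness
  rw [lintegral_rpow_eq_lintegral_measure_ofReal_lt (measurable_maximalFunction μ hg)
    (by linarith), mul_assoc]
  gcongr
  have hS : MeasurableSet {z : ℝ × E | ENNReal.ofReal z.1 < 2 * g z.2} :=
    measurableSet_lt (by fun_prop) (by fun_prop)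
  have key := lintegral_mul_setLIntegral_swap (μ := volume.restrict (Ioi (0 : ℝ))) (ν := μ) hS
    (ψ := fun t => ENNReal.ofReal (t ^ (p - 1 - 1))) (by fun_prop) hg
  simp only [mem_ofPred_eq, lintegral_rpow_sub_one_ofReal_lt hp1] at key
  calc ∫⁻ t in Ioi 0, ENNReal.ofReal (t ^ (p - 1)) *
        μ {y | ENNReal.ofReal t < maximalFunction μ g y}
      ≤ ∫⁻ t in Ioi 0, D * (ENNReal.ofReal (t ^ (p - 1 - 1)) *
          ∫⁻ y in {y | ENNReal.ofReal t < 2 * g y}, g y ∂μ) := by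
        refine setLIntegral_mono' measurableSet_Ioi fun t (ht : 0 < t) => ?_
        have h1 : ENNReal.ofReal (t ^ (p - 1)) =
            ENNReal.ofReal (t ^ (p - 1 - 1)) * ENNReal.ofReal t := by
          rw [← ENNReal.ofReal_mul (by positivity), Real.rpow_sub_one ht.ne' (p - 1),
            div_mul_cancel₀ _ ht.ne']
        rw [h1, mul_assoc, mul_left_comm D]
        exact mul_le_mul_right (mul_measure_lt_maximalFunction_le_setLIntegral μ hg _) _
    _ = D * ∫⁻ y, g y * ((2 * g y) ^ (p - 1) / ENNReal.ofReal (p - 1)) ∂μ := by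
        rw [lintegral_const_mul' _ _ (by finiteness), key]
    _ = D * (2 ^ (p - 1) / ENNReal.ofReal (p - 1)) * ∫⁻ x, g x ^ p ∂μ := by
        rw [mul_assoc D]
        congr 1
        rw [← lintegral_const_mul _ (by fun_prop)]
        refine lintegral_congr fun y => ?_
        rw [ENNReal.mul_rpow_of_nonneg _ _ hp1.le, div_eq_mul_inv, div_eq_mul_inv,
          show p = 1 + (p - 1) by ring, ENNReal.rpow_add_of_nonneg _ _ zero_le_one (by simpa using hp1.le),
          ENNReal.rpow_one, show 1 + (p - 1) - 1 = p - 1 by ring]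
        ring

end Maximal

section Riesz

open Module

/-- Optimising `m A R ^ a + N B R ^ (-κ)` over `R > 0`. -/
theorem le_mul_rpow_mul_rpow_of_forall_le {X m N : ℝ≥0∞} {A B a κ : ℝ} (hA : 0 < A) (hB : 0 < B)
    (ha : 0 < a) (hκ : 0 < κ) (hN0 : N ≠ 0) (hN : N ≠ ⊤)
    (h : ∀ R : ℝ, 0 < R →
      X ≤ m * ENNReal.ofReal (A * R ^ a) + N * ENNReal.ofReal (B * R ^ (-κ))) :
    X ≤ ENNReal.ofReal (A + B) * (m ^ (κ / (a + κ)) * N ^ (a / (a + κ))) := by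
  have hAB : ENNReal.ofReal (A + B) ≠ 0 := by simpa using by positivity
  rcases eq_or_ne m ⊤ with rfl | hm
  · rw [ENNReal.top_rpow_of_pos (by positivity),
      ENNReal.top_mul (ENNReal.rpow_pos (pos_iff_ne_zero.2 hN0) hN).ne', ENNReal.mul_top hAB]
    exact le_top
  rcases eq_or_ne m 0 with rfl | hm0
  · simp only [zero_mul, zero_add] at h
    have hlim : Tendsto (fun R : ℝ => N * ENNReal.ofReal (B * R ^ (-κ))) atTop (𝓝 0) := by
      have h1 := ENNReal.tendsto_ofReal ((tendsto_rpow_neg_atTop hκ).const_mul B)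
      simpa using ENNReal.Tendsto.const_mul h1 (Or.inr hN)
    refine (ge_of_tendsto hlim ?_).trans zero_le
    filter_upwards [eventually_gt_atTop 0] with R hR using h R hR
  · have hm' : 0 < m.toReal := ENNReal.toReal_pos hm0 hm
    have hN' : 0 < N.toReal := ENNReal.toReal_pos hN0 hN
    set u := m.toReal
    set v := N.toReal
    have hmu : m = ENNReal.ofReal u := (ENNReal.ofReal_toReal hm).symm
    have hNv : N = ENNReal.ofReal v := (ENNReal.ofReal_toReal hN).symm
    have hak : a + κ ≠ 0 := by positivity
    have e1 : u * (v / u) ^ (a / (a + κ)) = u ^ (κ / (a + κ)) * v ^ (a / (a + κ)) := by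
      rw [Real.div_rpow hN'.le hm'.le,
        show κ / (a + κ) = 1 - a / (a + κ) by field_simp; ring, Real.rpow_sub hm', Real.rpow_one]
      field_simp
    have e2 : v * (v / u) ^ (-(κ / (a + κ))) = u ^ (κ / (a + κ)) * v ^ (a / (a + κ)) := by
      rw [Real.rpow_neg (by positivity), Real.div_rpow hN'.le hm'.le,
        show a / (a + κ) = 1 - κ / (a + κ) by field_simp; ring, Real.rpow_sub hN', Real.rpow_one]
      field_simp
    refine (h ((v / u) ^ (1 / (a + κ))) (by positivity)).trans (le_of_eq ?_)
    rw [← Real.rpow_mul (by positivity), ← Real.rpow_mul (by positivity), hmu, hNv,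
      ENNReal.ofReal_rpow_of_pos hm', ENNReal.ofReal_rpow_of_pos hN',
      ← ENNReal.ofReal_mul (by positivity), ← ENNReal.ofReal_mul (by positivity),
      ← ENNReal.ofReal_mul (by positivity), ← ENNReal.ofReal_mul (by positivity),
      ← ENNReal.ofReal_add (by positivity) (by positivity)]
    congr 1
    rw [show 1 / (a + κ) * a = a / (a + κ) by ring,
      show 1 / (a + κ) * -κ = -(κ / (a + κ)) by ring]
    linear_combination A * e1 + B * e2

variable {E : Type*} [NormedAddCommGroup E] [NormedSpace ℝ E] [MeasurableSpace E] (μ : Measure E)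

/-- A multiple of the Riesz potential of order `a`, written as a superposition of ball integrals. -/
def rieszPotential (a : ℝ) (g : E → ℝ≥0∞) (x : E) : ℝ≥0∞ :=
  ∫⁻ t in Ioi (0 : ℝ), ENNReal.ofReal (t ^ (a - finrank ℝ E - 1)) *
    ∫⁻ y in closedBall x (t / 2), g y ∂μ

theorem rieszPotential_eq_zero_of_lintegral_rpow_eq_zero {g : E → ℝ≥0∞} (hg : Measurable g)
    {p : ℝ} (hp : 0 < p) (a : ℝ) (h : ∫⁻ y, g y ^ p ∂μ = 0) (x : E) :
    rieszPotential μ a g x = 0 := by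
  rw [lintegral_eq_zero_iff (by fun_prop)] at h
  have h0 : g =ᵐ[μ] 0 := by
    filter_upwards [h] with y hy
    simpa [hp, hp.le, hp.not_gt] using hy
  have (r : ℝ) : ∫⁻ y in closedBall x r, g y ∂μ = 0 := by
    rw [lintegral_congr_ae (ae_restrict_of_ae h0)]
    simp
  simp [rieszPotential, this]

variable [FiniteDimensional ℝ E] [BorelSpace E] [μ.IsAddHaarMeasure]

theorem setLIntegral_closedBall_half_le {g : E → ℝ≥0∞} (hg : Measurable g) {p : ℝ} (hp : 1 < p)
    (x : E) {t : ℝ} (ht : 0 < t) :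
    ∫⁻ y in closedBall x (t / 2), g y ∂μ ≤
      (∫⁻ y in closedBall x (t / 2), g y ^ p ∂μ) ^ (1 / p) *
        (ENNReal.ofReal (t ^ (finrank ℝ E * (1 - 1 / p))) * μ (ball 0 1) ^ (1 - 1 / p)) := by
  have hp' : 0 ≤ 1 - 1 / p := by
    rw [sub_nonneg, div_le_one (by linarith)]
    exact hp.le
  refine (setLIntegral_le_rpow_mul_measure_rpow hg hp _).trans ?_
  gcongr
  rw [Real.rpow_mul ht.le, Real.rpow_natCast, ← ENNReal.ofReal_rpow_of_nonneg (by positivity) hp',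
    ← ENNReal.mul_rpow_of_nonneg _ _ hp', ← μ.addHaar_closedBall x ht.le]
  gcongr
  linarith

theorem lintegral_Ioi_closedBall_half_le {g : E → ℝ≥0∞} (hg : Measurable g) {p a κ : ℝ}
    (hp : 1 < p) (hκa : κ = finrank ℝ E / p - a) (x : E) {R : ℝ} (hR : 0 ≤ R) :
    ∫⁻ t in Ioi R, ENNReal.ofReal (t ^ (a - finrank ℝ E - 1)) *
        ∫⁻ y in closedBall x (t / 2), g y ∂μ ≤
      μ (ball 0 1) ^ (1 - 1 / p) * ∫⁻ t in Ioi R, ENNReal.ofReal (t ^ (-κ - 1)) *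
        (∫⁻ y in closedBall x (t / 2), g y ^ p ∂μ) ^ (1 / p) := by
  have hp' : 0 ≤ 1 - 1 / p := by
    rw [sub_nonneg, div_le_one (by linarith)]
    exact hp.le
  rw [← lintegral_const_mul' _ _ (ENNReal.rpow_ne_top_of_nonneg hp' measure_ball_lt_top.ne)]
  refine setLIntegral_mono' measurableSet_Ioi fun t ht => ?_
  have ht : 0 < t := hR.trans_lt ht
  calc _ ≤ ENNReal.ofReal (t ^ (a - finrank ℝ E - 1)) *
      ((∫⁻ y in closedBall x (t / 2), g y ^ p ∂μ) ^ (1 / p) *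
        (ENNReal.ofReal (t ^ (finrank ℝ E * (1 - 1 / p))) * μ (ball 0 1) ^ (1 - 1 / p))) := by
        gcongr
        exact setLIntegral_closedBall_half_le μ hg hp x ht
    _ = _ := by
        rw [show -κ - 1 = (a - finrank ℝ E - 1) + finrank ℝ E * (1 - 1 / p) by rw [hκa]; ring,
          Real.rpow_add ht, ENNReal.ofReal_mul (by positivity)]
        ring

/-- Hedberg's pointwise bound. -/
theorem rieszPotential_le_maximalFunction_rpow {g : E → ℝ≥0∞} (hg : Measurable g) {p a κ : ℝ}
    (hp : 1 < p) (ha : 0 < a) (hκ : 0 < κ) (hκa : κ = finrank ℝ E / p - a)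
    (hN0 : ∫⁻ y, g y ^ p ∂μ ≠ 0) (hN : ∫⁻ y, g y ^ p ∂μ ≠ ⊤) (x : E) :
    rieszPotential μ a g x ≤
      ENNReal.ofReal (μ.real (ball 0 1) / a + μ.real (ball 0 1) ^ (1 - 1 / p) / κ) *
        (maximalFunction μ g x ^ (κ / (a + κ)) *
          ((∫⁻ y, g y ^ p ∂μ) ^ (1 / p)) ^ (a / (a + κ))) := by
  have hp0 : 0 < p := by linarith
  have hp' : 0 ≤ 1 - 1 / p := by
    rw [sub_nonneg, div_le_one hp0]
    exact hp.le
  have hv : 0 < μ.real (ball (0 : E) 1) :=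
    ENNReal.toReal_pos (measure_ball_pos μ 0 one_pos).ne' measure_ball_lt_top.ne
  have hvE : μ (ball (0 : E) 1) = ENNReal.ofReal (μ.real (ball 0 1)) :=
    (ofReal_measureReal measure_ball_lt_top.ne).symm
  refine le_mul_rpow_mul_rpow_of_forall_le (by positivity) (by positivity) ha hκ
    (ENNReal.rpow_pos (pos_iff_ne_zero.2 hN0) hN).ne'
    (ENNReal.rpow_ne_top_of_nonneg (by positivity) hN) fun R hR => ?_
  rw [rieszPotential, ← Ioc_union_Ioi_eq_Ioi hR.le]
  refine (lintegral_union_le _ _ _).trans (add_le_add ?_ ?_)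
  · rw [setLIntegral_congr Ioo_ae_eq_Ioc.symm]
    calc _ ≤ ∫⁻ t in Ioo 0 R, maximalFunction μ g x * μ (ball 0 1) *
          ENNReal.ofReal (t ^ (a - 1)) := by
          refine setLIntegral_mono' measurableSet_Ioo fun t ht => ?_
          have ht0 : 0 < t := ht.1
          calc _ ≤ ENNReal.ofReal (t ^ (a - finrank ℝ E - 1)) *
              (maximalFunction μ g x * μ (closedBall x t)) := by
                gcongr
                exact setLIntegral_closedBall_le_maximalFunction μ g x (by positivity)
                  (by linarith)
            _ = _ := by
                rw [μ.addHaar_closedBall x ht0.le,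
                  show a - 1 = (a - finrank ℝ E - 1) + finrank ℝ E by ring,
                  Real.rpow_add ht0, ENNReal.ofReal_mul (by positivity), Real.rpow_natCast]
                ring
      _ = maximalFunction μ g x * μ (ball 0 1) * ENNReal.ofReal (R ^ a / a) := by
          rw [lintegral_const_mul _ (by fun_prop), lintegral_Ioo_rpow_sub_one ha hR.le]
      _ = _ := by
          rw [mul_assoc, hvE, ← ENNReal.ofReal_mul hv.le]
          ring_nf
  · refine (lintegral_Ioi_closedBall_half_le μ hg hp hκa x hR.le).trans ?_
    calc _ ≤ μ (ball 0 1) ^ (1 - 1 / p) * ∫⁻ t in Ioi R, ENNReal.ofReal (t ^ (-κ - 1)) *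
        (∫⁻ y, g y ^ p ∂μ) ^ (1 / p) := by
          gcongr
          exact Measure.restrict_le_self
      _ = μ (ball 0 1) ^ (1 - 1 / p) * (ENNReal.ofReal (R ^ (-κ) / κ) *
          (∫⁻ y, g y ^ p ∂μ) ^ (1 / p)) := by
          rw [lintegral_mul_const _ (by fun_prop), lintegral_Ioi_rpow_neg_sub_one hκ hR]
      _ = _ := by
          rw [hvE, ENNReal.ofReal_rpow_of_nonneg hv.le hp', ← mul_assoc,
            ← ENNReal.ofReal_mul (by positivity), mul_comm]
          ring_nf

/-- The Hardy–Littlewood–Sobolev inequality. -/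
theorem exists_lintegral_rieszPotential_rpow_le [Nontrivial E] {p q a : ℝ} (hp : 1 < p)
    (ha : 0 < a) (hq0 : 0 < q) (hq : 1 / q = 1 / p - a / finrank ℝ E) :
    ∃ C : ℝ≥0∞, C ≠ ⊤ ∧ ∀ g : E → ℝ≥0∞, Measurable g →
      (∫⁻ x, rieszPotential μ a g x ^ q ∂μ) ^ (1 / q) ≤ C * (∫⁻ x, g x ^ p ∂μ) ^ (1 / p) := by
  obtain ⟨D, hD, hmax⟩ := exists_lintegral_maximalFunction_rpow_le μ hp
  have hp0 : 0 < p := by linarith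
  have hd : (0 : ℝ) < finrank ℝ E := by exact_mod_cast finrank_pos
  set κ : ℝ := finrank ℝ E / p - a with hκa
  have hκq : κ = finrank ℝ E / q := by
    rw [hκa, div_eq_mul_one_div _ q, hq]
    field_simp
  have hκ : 0 < κ := hκq ▸ div_pos hd hq0
  have haκ : a + κ = finrank ℝ E / p := by rw [hκa]; ring
  have e1 : κ / (a + κ) = p / q := by rw [haκ, hκq]; field_simp
  have e2 : a / (a + κ) = 1 - p / q := by
    rw [← e1]
    field_simp
    ring
  have e2' : 0 ≤ 1 - p / q := e2 ▸ by positivity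
  set K : ℝ≥0∞ := ENNReal.ofReal (μ.real (ball 0 1) / a + μ.real (ball 0 1) ^ (1 - 1 / p) / κ)
  refine ⟨K * D ^ (1 / q) + 1, ?_, fun g hg => ?_⟩
  · have : D ^ (1 / q) ≠ ⊤ := ENNReal.rpow_ne_top_of_nonneg (by positivity) hD
    finiteness
  rcases eq_or_ne (∫⁻ y, g y ^ p ∂μ) 0 with hN0 | hN0
  · simp [rieszPotential_eq_zero_of_lintegral_rpow_eq_zero μ hg hp0 a hN0, hq0]
  rcases eq_or_ne (∫⁻ y, g y ^ p ∂μ) ⊤ with hN | hN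
  · rw [hN, ENNReal.top_rpow_of_pos (by positivity), ENNReal.mul_top (by simp)]
    exact le_top
  set N := (∫⁻ y, g y ^ p ∂μ) ^ (1 / p)
  have hNtop : N ≠ ⊤ := ENNReal.rpow_ne_top_of_nonneg (by positivity) hN
  have hNp : ∫⁻ y, g y ^ p ∂μ = N ^ p := by
    rw [← ENNReal.rpow_mul, one_div_mul_cancel hp0.ne', ENNReal.rpow_one]
  have hpt (x : E) : rieszPotential μ a g x ^ q ≤
      K ^ q * N ^ (q - p) * maximalFunction μ g x ^ p := by
    have h := rieszPotential_le_maximalFunction_rpow μ hg hp ha hκ hκa hN0 hN x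
    rw [e1, e2] at h
    refine (ENNReal.rpow_le_rpow h hq0.le).trans (le_of_eq ?_)
    rw [ENNReal.mul_rpow_of_nonneg _ _ hq0.le, ENNReal.mul_rpow_of_nonneg _ _ hq0.le,
      ← ENNReal.rpow_mul, ← ENNReal.rpow_mul, div_mul_cancel₀ _ hq0.ne',
      show (1 - p / q) * q = q - p by field_simp]
    ring
  have hqp : 0 ≤ q - p := by
    have := mul_nonneg e2' hq0.le
    rwa [show (1 - p / q) * q = q - p by field_simp] at this
  have hfin : K ^ q * N ^ (q - p) ≠ ⊤ :=
    ENNReal.mul_ne_top (ENNReal.rpow_ne_top_of_nonneg hq0.le ofReal_ne_top)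
      (ENNReal.rpow_ne_top_of_nonneg hqp hNtop)
  calc (∫⁻ x, rieszPotential μ a g x ^ q ∂μ) ^ (1 / q)
      ≤ (K ^ q * N ^ (q - p) * (D * N ^ p)) ^ (1 / q) := by
        gcongr
        calc _ ≤ ∫⁻ x, K ^ q * N ^ (q - p) * maximalFunction μ g x ^ p ∂μ := lintegral_mono hpt
          _ = K ^ q * N ^ (q - p) * ∫⁻ x, maximalFunction μ g x ^ p ∂μ :=
              lintegral_const_mul' _ _ hfin
          _ ≤ _ := by
              rw [← hNp]
              gcongr
              exact hmax g hg
    _ = (K ^ q * D * N ^ q) ^ (1 / q) := by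
        rw [show N ^ q = N ^ (q - p) * N ^ p by
          rw [← ENNReal.rpow_add_of_nonneg _ _ hqp hp0.le, sub_add_cancel]]
        ring_nf
    _ = K * D ^ (1 / q) * N := by
        have h1 : 0 ≤ 1 / q := by positivity
        rw [ENNReal.mul_rpow_of_nonneg _ _ h1, ENNReal.mul_rpow_of_nonneg _ _ h1,
          ← ENNReal.rpow_mul, ← ENNReal.rpow_mul, mul_one_div_cancel hq0.ne', ENNReal.rpow_one,
          ENNReal.rpow_one]
    _ ≤ _ := by
        gcongr
        exact le_self_add

end Riesz

section Local

open Module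

variable {E : Type*} [NormedAddCommGroup E] [NormedSpace ℝ E] [FiniteDimensional ℝ E]
  [MeasurableSpace E] [BorelSpace E] (μ : Measure E) [μ.IsAddHaarMeasure]

theorem rieszPotential_le_indicator_add {g : E → ℝ≥0∞} (hg : Measurable g) {p a κ : ℝ}
    (hp : 1 < p) (hκa : κ = finrank ℝ E / p - a) {x₀ x : E} {r : ℝ} (hr : 0 < r)
    (hx : x ∈ ball x₀ r) :
    rieszPotential μ a g x ≤ rieszPotential μ a ((ball x₀ (2 * r)).indicator g) x +
      μ (ball 0 1) ^ (1 - 1 / p) * ∫⁻ t in Ioi (2 * r), ENNReal.ofReal (t ^ (-κ - 1)) *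
        (∫⁻ y in ball x₀ t, g y ^ p ∂μ) ^ (1 / p) := by
  have hsub {t s : ℝ} (h : t / 2 + r ≤ s) : closedBall x (t / 2) ⊆ ball x₀ s := fun y hy => by
    have h1 := dist_triangle y x x₀
    have h2 := mem_closedBall.1 hy
    have h3 := mem_ball.1 hx
    exact mem_ball.2 (by linarith)
  have hp0 : 0 ≤ 1 / p := by positivity
  rw [rieszPotential, ← Ioc_union_Ioi_eq_Ioi (show 0 ≤ 2 * r by positivity)]
  refine (lintegral_union_le _ _ _).trans (add_le_add ?_ ?_)
  · refine le_trans ?_ (lintegral_mono_set (s := Ioc 0 (2 * r)) Ioc_subset_Ioi_self)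
    refine setLIntegral_mono' measurableSet_Ioc fun t ht => ?_
    refine mul_le_mul_right (setLIntegral_mono' measurableSet_closedBall fun y hy => ?_) _
    rw [indicator_of_mem (hsub (by linarith [ht.2]) hy)]
  · refine (lintegral_Ioi_closedBall_half_le μ hg hp hκa x (by positivity)).trans ?_
    refine mul_le_mul_right (setLIntegral_mono' measurableSet_Ioi fun t ht => ?_) _
    gcongr
    have := mem_Ioi.1 ht
    exact hsub (by linarith)

/-- The local estimate of Guliyev type for the Riesz potential. -/
theorem exists_setLIntegral_ball_rieszPotential_rpow_le [Nontrivial E] {p q a : ℝ} (hp : 1 < p)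
    (ha : 0 < a) (hq0 : 0 < q) (hq : 1 / q = 1 / p - a / finrank ℝ E) :
    ∃ C : ℝ≥0∞, C ≠ ⊤ ∧ ∀ g : E → ℝ≥0∞, Measurable g → ∀ (x₀ : E) (r : ℝ), 0 < r →
      (∫⁻ x in ball x₀ r, rieszPotential μ a g x ^ q ∂μ) ^ (1 / q) ≤
        C * μ (ball x₀ r) ^ (1 / q) *
          ∫⁻ t in Ioi (2 * r), ENNReal.ofReal (t ^ (-(finrank ℝ E) / q - 1)) *
            (∫⁻ y in ball x₀ t, g y ^ p ∂μ) ^ (1 / p) := by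
  obtain ⟨D, hD, hHLS⟩ := exists_lintegral_rieszPotential_rpow_le μ hp ha hq0 hq
  have hp0 : 0 < p := by linarith
  have hd : (0 : ℝ) < finrank ℝ E := by exact_mod_cast finrank_pos
  set κ : ℝ := finrank ℝ E / q with hκ
  have hκ0 : 0 < κ := by positivity
  have hκa : κ = finrank ℝ E / p - a := by
    rw [hκ, div_eq_mul_one_div _ q, hq]
    field_simp
  have hq1 : 1 ≤ q := by
    have h1 : 1 / q ≤ 1 := by
      have := div_pos ha hd
      have := (div_lt_one hp0).2 hp
      linarith
    rwa [div_le_one hq0] at h1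
  have hv0 : μ (ball (0 : E) 1) ≠ 0 := (measure_ball_pos μ 0 one_pos).ne'
  have hv : μ (ball (0 : E) 1) ≠ ⊤ := measure_ball_lt_top.ne
  have hp' : 0 ≤ 1 - 1 / p := by
    rw [sub_nonneg, div_le_one hp0]
    exact hp.le
  have hqi : 0 ≤ 1 / q := by positivity
  set W := μ (ball (0 : E) 1) ^ (1 / q) with hW
  have hW0 : W ≠ 0 := (ENNReal.rpow_pos (pos_iff_ne_zero.2 hv0) hv).ne'
  have hWt : W ≠ ⊤ := ENNReal.rpow_ne_top_of_nonneg hqi hv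
  set S := μ (ball (0 : E) 1) ^ (1 - 1 / p)
  have hSt : S ≠ ⊤ := ENNReal.rpow_ne_top_of_nonneg hp' hv
  refine ⟨2 * (D * (ENNReal.ofReal (κ * 2 ^ κ) / W) + S), by finiteness, fun g hg x₀ r hr => ?_⟩
  rw [show -(finrank ℝ E : ℝ) / q - 1 = -κ - 1 by rw [hκ, neg_div]]
  set Φ : ℝ → ℝ≥0∞ := fun t => (∫⁻ y in ball x₀ t, g y ^ p ∂μ) ^ (1 / p) with hΦ
  set T := ∫⁻ t in Ioi (2 * r), ENNReal.ofReal (t ^ (-κ - 1)) * Φ t with hT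
  set g₁ := (ball x₀ (2 * r)).indicator g with hg₁
  have hmball : μ (ball x₀ r) ^ (1 / q) = ENNReal.ofReal (r ^ κ) * W := by
    rw [μ.addHaar_ball x₀ hr.le, ENNReal.mul_rpow_of_nonneg _ _ hqi,
      ENNReal.ofReal_rpow_of_nonneg (by positivity) hqi, ← Real.rpow_natCast,
      ← Real.rpow_mul hr.le, hκ, mul_one_div]
  have hg₁Φ : (∫⁻ x, g₁ x ^ p ∂μ) ^ (1 / p) = Φ (2 * r) := by
    rw [hΦ]
    congr 1
    rw [← lintegral_indicator measurableSet_ball]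
    refine lintegral_congr fun y => ?_
    by_cases hy : y ∈ ball x₀ (2 * r)
    · simp only [hg₁, indicator_of_mem hy]
    · simp only [hg₁, indicator_of_notMem hy, ENNReal.zero_rpow_of_pos hp0]
  have hΦT : Φ (2 * r) ≤ ENNReal.ofReal (κ * 2 ^ κ) / W * μ (ball x₀ r) ^ (1 / q) * T := by
    have h1 : ENNReal.ofReal ((2 * r) ^ (-κ) / κ) * Φ (2 * r) ≤ T := by
      rw [← lintegral_Ioi_rpow_neg_sub_one hκ0 (by positivity), hT,
        ← lintegral_mul_const _ (by fun_prop)]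
      refine setLIntegral_mono' measurableSet_Ioi fun t ht => ?_
      have := (mem_Ioi.1 ht).le
      simp only [hΦ]
      gcongr
    have h2 : ENNReal.ofReal (κ * 2 ^ κ) * ENNReal.ofReal (r ^ κ) *
        ENNReal.ofReal ((2 * r) ^ (-κ) / κ) = 1 := by
      rw [← ENNReal.ofReal_mul (by positivity), ← ENNReal.ofReal_mul (by positivity),
        ENNReal.ofReal_eq_one, Real.rpow_neg (by positivity),
        Real.mul_rpow (by positivity) (by positivity)]
      field_simp
    calc Φ (2 * r) = ENNReal.ofReal (κ * 2 ^ κ) * ENNReal.ofReal (r ^ κ) *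
          (ENNReal.ofReal ((2 * r) ^ (-κ) / κ) * Φ (2 * r)) := by
          rw [← mul_assoc, h2, one_mul]
      _ ≤ ENNReal.ofReal (κ * 2 ^ κ) * ENNReal.ofReal (r ^ κ) * T := by gcongr
      _ = _ := by
          rw [hmball, mul_comm (ENNReal.ofReal (r ^ κ)) W, ← mul_assoc,
            ENNReal.div_mul_cancel hW0 hWt]
  set A := (∫⁻ x, rieszPotential μ a g₁ x ^ q ∂μ) ^ (1 / q)
  have hA : A ≤ D * Φ (2 * r) := hg₁Φ ▸ hHLS g₁ (hg.indicator measurableSet_ball)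
  have hAq : ∫⁻ x, rieszPotential μ a g₁ x ^ q ∂μ = A ^ q := by
    rw [← ENNReal.rpow_mul, one_div_mul_cancel hq0.ne', ENNReal.rpow_one]
  set B := S * T * μ (ball x₀ r) ^ (1 / q)
  have hB : (S * T) ^ q * μ (ball x₀ r) = B ^ q := by
    rw [ENNReal.mul_rpow_of_nonneg (S * T) _ hq0.le, ← ENNReal.rpow_mul,
      one_div_mul_cancel hq0.ne', ENNReal.rpow_one]
  have hint : ∫⁻ x in ball x₀ r, rieszPotential μ a g x ^ q ∂μ ≤ (2 * (A + B)) ^ q := by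
    calc _ ≤ ∫⁻ x in ball x₀ r, 2 ^ q * (rieszPotential μ a g₁ x ^ q + (S * T) ^ q) ∂μ := by
          refine setLIntegral_mono' measurableSet_ball fun x hx => ?_
          calc _ ≤ (rieszPotential μ a g₁ x + S * T) ^ q := by
                gcongr
                exact rieszPotential_le_indicator_add μ hg hp hκa hr hx
            _ ≤ _ := ENNReal.rpow_add_le_mul_rpow_add_rpow _ _ hq1
            _ ≤ _ := by
                gcongr
                · norm_num
                · linarith
      _ = 2 ^ q * ((∫⁻ x in ball x₀ r, rieszPotential μ a g₁ x ^ q ∂μ) +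
            (S * T) ^ q * μ (ball x₀ r)) := by
          rw [lintegral_const_mul' _ _ (ENNReal.rpow_ne_top_of_nonneg hq0.le (by simp)),
            lintegral_add_right _ measurable_const, setLIntegral_const]
      _ ≤ 2 ^ q * (A ^ q + B ^ q) := by
          rw [hB, ← hAq]
          gcongr
          exact Measure.restrict_le_self
      _ ≤ _ := by
          rw [ENNReal.mul_rpow_of_nonneg 2 (A + B) hq0.le]
          gcongr
          exact ENNReal.add_rpow_le_rpow_add _ _ hq1
  calc _ ≤ ((2 * (A + B)) ^ q) ^ (1 / q) := by gcongr
    _ = 2 * (A + B) := by rw [← ENNReal.rpow_mul, mul_one_div_cancel hq0.ne', ENNReal.rpow_one]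
    _ ≤ 2 * (D * (ENNReal.ofReal (κ * 2 ^ κ) / W * μ (ball x₀ r) ^ (1 / q) * T) + B) := by
        gcongr
        exact hA.trans (by gcongr)
    _ = _ := by ring

theorem lintegral_rpow_mul_setLIntegral_closedBall [Nontrivial E] {h : E → ℝ≥0∞}
    (hh : Measurable h) {β c : ℝ} (hβ : 0 < β) (hc : 0 < c) (x : E) :
    ∫⁻ t in Ioi (0 : ℝ), ENNReal.ofReal (t ^ (-β - 1)) * ∫⁻ y in closedBall x (t / c), h y ∂μ =
      ∫⁻ y, h y * ENNReal.ofReal ((c * dist y x) ^ (-β) / β) ∂μ := by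
  have hS : MeasurableSet {z : ℝ × E | dist z.2 x ≤ z.1 / c} :=
    measurableSet_le (by fun_prop) (by fun_prop)
  refine (lintegral_mul_setLIntegral_swap (μ := volume.restrict (Ioi (0 : ℝ))) (ν := μ) hS
    (ψ := fun t => ENNReal.ofReal (t ^ (-β - 1))) (by fun_prop) hh).trans ?_
  refine lintegral_congr_ae ?_
  filter_upwards [compl_mem_ae_iff.2 (measure_singleton (μ := μ) x)] with y hy
  have hd : 0 < dist y x := dist_pos.2 hy
  have hset : {t : ℝ | dist y x ≤ t / c} ∩ Ioi 0 =
      Ici (c * dist y x) := by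
    ext t
    simp only [mem_ofPred_eq, mem_inter_iff, mem_Ioi, mem_Ici, le_div_iff₀ hc, mul_comm c]
    exact and_iff_left_of_imp fun ht => (mul_pos hd hc).trans_le ht
  rw [Measure.restrict_restrict (measurableSet_le (by fun_prop) (by fun_prop)), hset,
    setLIntegral_congr Ioi_ae_eq_Ici.symm, lintegral_Ioi_rpow_neg_sub_one hβ (by positivity)]

end Local

section Marcinkiewicz

open Module

variable {n : ℕ}

/-- A Lipschitz function on the sphere that is homogeneous of degree zero is bounded. -/
theorem HomogZero.exists_abs_le [Nontrivial (EuclideanSpace ℝ (Fin n))]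
    {Ω : EuclideanSpace ℝ (Fin n) → ℝ} (hΩ : HomogZero Ω) {γ M : ℝ} (hγ : 0 < γ)
    (hΩLip : ∀ x y : sphere (0 : EuclideanSpace ℝ (Fin n)) 1,
      |Ω (x : EuclideanSpace ℝ (Fin n)) - Ω (y : EuclideanSpace ℝ (Fin n))| ≤
        M * ‖(x : EuclideanSpace ℝ (Fin n)) - (y : EuclideanSpace ℝ (Fin n))‖ ^ γ) :
    ∃ K : ℝ, 0 < K ∧ ∀ z, z ≠ 0 → |Ω z| ≤ K := by
  obtain ⟨e, he⟩ := NormedSpace.sphere_nonempty (x := (0 : EuclideanSpace ℝ (Fin n))).2 zero_le_one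
  refine ⟨|Ω e| + |M| * 2 ^ γ + 1, by positivity, fun z hz => ?_⟩
  have hz' : 0 < ‖z‖ := norm_pos_iff.2 hz
  have hw : ‖z‖⁻¹ • z ∈ sphere (0 : EuclideanSpace ℝ (Fin n)) 1 := by
    rw [mem_sphere_zero_iff_norm, norm_smul, norm_inv, norm_norm, inv_mul_cancel₀ hz'.ne']
  have hd : ‖‖z‖⁻¹ • z - e‖ ≤ 2 := by
    have := norm_sub_le (‖z‖⁻¹ • z) e
    rw [mem_sphere_zero_iff_norm.1 hw, mem_sphere_zero_iff_norm.1 he] at this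
    linarith
  have h1 := hΩLip ⟨_, hw⟩ ⟨e, he⟩
  have h2 : M * ‖‖z‖⁻¹ • z - e‖ ^ γ ≤ |M| * 2 ^ γ := by
    gcongr
    exact le_abs_self M
  have h3 := abs_sub_abs_le_abs_sub (Ω (‖z‖⁻¹ • z)) (Ω e)
  rw [← hΩ ‖z‖⁻¹ (inv_pos.2 hz') z hz]
  dsimp only at h1
  linarith

theorem enorm_FMarc_le [Nontrivial (EuclideanSpace ℝ (Fin n))]
    {Ω f : EuclideanSpace ℝ (Fin n) → ℝ} {K : ℝ} (hK : ∀ z, z ≠ 0 → |Ω z| ≤ K)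
    {g : EuclideanSpace ℝ (Fin n) → ℝ≥0∞} (hfg : (fun y => ‖f y‖ₑ) =ᵐ[volume] g) (α t : ℝ)
    (x : EuclideanSpace ℝ (Fin n)) :
    ‖FMarc Ω f α t x‖ₑ ≤ ENNReal.ofReal K *
      ∫⁻ y in closedBall x t, g y * ENNReal.ofReal (dist y x ^ (α + 1 - n)) := by
  refine (enorm_integral_le_lintegral_enorm _).trans ?_
  rw [← lintegral_const_mul' _ _ ofReal_ne_top]
  refine lintegral_mono_ae (ae_restrict_of_ae ?_)
  filter_upwards [compl_mem_ae_iff.2 (measure_singleton (μ := volume) x), hfg] with y hy hfy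
  have hxy : x - y ≠ 0 := sub_ne_zero.2 (Ne.symm hy)
  have hd : 0 < ‖x - y‖ := norm_pos_iff.2 hxy
  rw [div_eq_mul_inv, enorm_mul, enorm_mul, hfy, ← Real.rpow_neg hd.le,
    Real.enorm_of_nonneg (Real.rpow_nonneg hd.le _), dist_eq_norm', mul_assoc,
    show -((n : ℝ) - 1 - α) = α + 1 - n by ring]
  gcongr
  rw [Real.enorm_eq_ofReal_abs]
  exact ENNReal.ofReal_le_ofReal (hK _ hxy)

/-- The Marcinkiewicz integral is controlled pointwise by the Riesz potential. -/
theorem marcinkiewicz_le_rieszPotential [Nontrivial (EuclideanSpace ℝ (Fin n))]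
    {Ω f : EuclideanSpace ℝ (Fin n) → ℝ} {K : ℝ} (hK : ∀ z, z ≠ 0 → |Ω z| ≤ K)
    {g : EuclideanSpace ℝ (Fin n) → ℝ≥0∞} (hg : Measurable g)
    (hfg : (fun y => ‖f y‖ₑ) =ᵐ[volume] g) {α : ℝ} (hαn : α < n)
    (x : EuclideanSpace ℝ (Fin n)) :
    marcinkiewicz Ω f α x ≤
      ENNReal.ofReal K * ENNReal.ofReal ((n - α) * 2 ^ (n - α)) * rieszPotential volume α g x := by
  have hβ : 0 < (n : ℝ) - α := by linarith
  set h : EuclideanSpace ℝ (Fin n) → ℝ≥0∞ :=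
    fun y => g y * ENNReal.ofReal (dist y x ^ (α + 1 - n))
  have hh : Measurable h := by fun_prop
  set H : ℝ → ℝ≥0∞ := fun t => ∫⁻ y in closedBall x t, h y
  have hHmono : Monotone H := fun s t hst =>
    lintegral_mono_set (closedBall_subset_closedBall hst)
  set J := ∫⁻ t in Ioi (0 : ℝ), ENNReal.ofReal (t ^ (-1 - 1 : ℝ)) * H t with hJ
  have hJ_eq : J = ENNReal.ofReal ((n - α) * 2 ^ (n - α)) * rieszPotential volume α g x := by
    have h1 := lintegral_rpow_mul_setLIntegral_closedBall volume hh one_pos one_pos x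
    have h2 := lintegral_rpow_mul_setLIntegral_closedBall volume hg hβ two_pos x
    simp only [div_one, one_mul] at h1
    rw [rieszPotential, finrank_euclideanSpace_fin, show α - n - 1 = -(n - α) - 1 by ring, h2, hJ,
      h1, ← lintegral_const_mul' _ _ ofReal_ne_top]
    refine lintegral_congr_ae ?_
    filter_upwards [compl_mem_ae_iff.2 (measure_singleton (μ := volume) x)] with y hy
    have hd : 0 < dist y x := dist_pos.2 hy
    rw [mul_assoc, mul_left_comm (ENNReal.ofReal _), ← ENNReal.ofReal_mul (by positivity),
      ← ENNReal.ofReal_mul (by positivity)]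
    congr 2
    rw [Real.mul_rpow zero_le_two hd.le, Real.rpow_neg zero_le_two, ← Real.rpow_add hd,
      show α + 1 - n + -1 = -(n - α) by ring]
    field_simp
  have hHJ {t : ℝ} (ht : 0 < t) : ENNReal.ofReal t⁻¹ * H t ≤ J := by
    have h1 := lintegral_Ioi_rpow_neg_sub_one one_pos ht
    rw [div_one, Real.rpow_neg_one] at h1
    rw [← h1, ← lintegral_mul_const _ (by fun_prop)]
    refine le_trans ?_ (lintegral_mono_set (Ioi_subset_Ioi ht.le))
    refine setLIntegral_mono' measurableSet_Ioi fun s hs => ?_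
    gcongr
    exact hHmono (mem_Ioi.1 hs).le
  have hsq : ∫⁻ t in Ioi (0 : ℝ), ENNReal.ofReal ((FMarc Ω f α t x) ^ 2 / t ^ 3) ≤
      (ENNReal.ofReal K * J) ^ (2 : ℝ) := by
    calc _ ≤ ∫⁻ t in Ioi (0 : ℝ), ENNReal.ofReal K ^ 2 * J *
          (ENNReal.ofReal (t ^ (-1 - 1 : ℝ)) * H t) := by
          refine setLIntegral_mono' measurableSet_Ioi fun t (ht : 0 < t) => ?_
          have e1 : FMarc Ω f α t x ^ 2 / t ^ 3 =
              |FMarc Ω f α t x| ^ 2 * (t⁻¹ * t ^ (-1 - 1 : ℝ)) := by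
            rw [sq_abs, Real.rpow_sub_one ht.ne', Real.rpow_neg_one]
            field_simp
          have e2 : ENNReal.ofReal (|FMarc Ω f α t x| ^ 2) ≤ (ENNReal.ofReal K * H t) ^ 2 := by
            rw [ENNReal.ofReal_pow (abs_nonneg _), ← Real.enorm_eq_ofReal_abs]
            gcongr
            exact enorm_FMarc_le hK hfg α t x
          calc _ ≤ (ENNReal.ofReal K * H t) ^ 2 *
                (ENNReal.ofReal t⁻¹ * ENNReal.ofReal (t ^ (-1 - 1 : ℝ))) := by
                rw [e1, ENNReal.ofReal_mul (by positivity), ENNReal.ofReal_mul (by positivity)]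
                gcongr
            _ = ENNReal.ofReal K ^ 2 * (ENNReal.ofReal t⁻¹ * H t) *
                (ENNReal.ofReal (t ^ (-1 - 1 : ℝ)) * H t) := by ring
            _ ≤ _ := by
                gcongr
                exact hHJ ht
      _ = ENNReal.ofReal K ^ 2 * J * J := by
          have := hHmono.measurable
          rw [lintegral_const_mul _ (by fun_prop)]
      _ = _ := by
          rw [ENNReal.rpow_two]
          ring
  calc marcinkiewicz Ω f α x ≤ ((ENNReal.ofReal K * J) ^ (2 : ℝ)) ^ ((1 : ℝ) / 2) := by
        unfold marcinkiewicz
        gcongr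
    _ = _ := by
        rw [← ENNReal.rpow_mul, hJ_eq, mul_assoc]
        norm_num

end Marcinkiewicz

/-- The `L_p` norm over a ball is controlled by the local Morrey norm and the essential infimum of
the weight over all larger radii. -/
theorem LpB_le_LMnorm_mul_essInf {n : ℕ} {p : ℝ} (hp : 0 < p)
    {φ : EuclideanSpace ℝ (Fin n) → ℝ → ℝ} (x₀ : EuclideanSpace ℝ (Fin n))
    (hφ : ∀ r : ℝ, 0 < r → 0 < φ x₀ r) (f : EuclideanSpace ℝ (Fin n) → ℝ)
    (hf : LMnorm p φ x₀ f ≠ ⊤) {t : ℝ} (ht : 0 < t) :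
    LpB p f x₀ t ≤
      LMnorm p φ x₀ f * volume (ball (0 : EuclideanSpace ℝ (Fin n)) 1) ^ (1 / p) *
        essInf (fun τ => ENNReal.ofReal (φ x₀ τ * τ ^ ((n : ℝ) / p)))
          (volume.restrict (Ioi t)) := by
  have hp' : 0 ≤ 1 / p := by positivity
  set c := LMnorm p φ x₀ f * volume (ball (0 : EuclideanSpace ℝ (Fin n)) 1) ^ (1 / p)
  have hc : c ≠ ⊤ :=
    ENNReal.mul_ne_top hf (ENNReal.rpow_ne_top_of_nonneg hp' measure_ball_lt_top.ne)
  have hτ {τ : ℝ} (hτ : t < τ) :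
      LpB p f x₀ t ≤ c * ENNReal.ofReal (φ x₀ τ * τ ^ ((n : ℝ) / p)) := by
    have hτ0 : 0 < τ := ht.trans hτ
    have hB0 : volume (ball x₀ τ) ≠ 0 := (measure_ball_pos volume x₀ hτ0).ne'
    have hB : volume (ball x₀ τ) ≠ ⊤ := measure_ball_lt_top.ne
    have hφ0 : ENNReal.ofReal (φ x₀ τ) ≠ 0 := by simpa using hφ τ hτ0
    have h1 : (ENNReal.ofReal (φ x₀ τ))⁻¹ * volume (ball x₀ τ) ^ (-(1 / p)) * LpB p f x₀ τ ≤
        LMnorm p φ x₀ f :=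
      le_iSup (fun r : {r : ℝ // 0 < r} => (ENNReal.ofReal (φ x₀ r))⁻¹ *
        (volume (ball x₀ (r : ℝ))) ^ (-(1 / p)) * LpB p f x₀ r) ⟨τ, hτ0⟩
    calc LpB p f x₀ t ≤ LpB p f x₀ τ :=
          eLpNorm_mono_measure _ (Measure.restrict_mono (ball_subset_ball hτ.le) le_rfl)
      _ = ENNReal.ofReal (φ x₀ τ) * volume (ball x₀ τ) ^ (1 / p) * ((ENNReal.ofReal (φ x₀ τ))⁻¹ *
            volume (ball x₀ τ) ^ (-(1 / p)) * LpB p f x₀ τ) := by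
          rw [ENNReal.rpow_neg, ← ENNReal.mul_inv (Or.inl hφ0) (Or.inl ofReal_ne_top), ← mul_assoc,
            ENNReal.mul_inv_cancel, one_mul]
          · exact mul_ne_zero hφ0 (ENNReal.rpow_pos (pos_iff_ne_zero.2 hB0) hB).ne'
          · exact ENNReal.mul_ne_top ofReal_ne_top (ENNReal.rpow_ne_top_of_nonneg hp' hB)
      _ ≤ ENNReal.ofReal (φ x₀ τ) * volume (ball x₀ τ) ^ (1 / p) * LMnorm p φ x₀ f := by gcongr
      _ = _ := by
          rw [Measure.addHaar_ball_of_pos volume x₀ hτ0, finrank_euclideanSpace_fin,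
            ENNReal.mul_rpow_of_nonneg _ _ hp', ENNReal.ofReal_rpow_of_nonneg (by positivity) hp',
            ← Real.rpow_natCast, ← Real.rpow_mul hτ0.le, mul_one_div,
            ENNReal.ofReal_mul (hφ τ hτ0).le]
          ring
  rcases eq_or_ne c 0 with hc0 | hc0
  · simpa [hc0] using hτ (lt_add_one t)
  · rw [mul_comm, ← ENNReal.div_le_iff hc0 hc]
    refine le_essInf_of_ae_le _ ?_
    filter_upwards [ae_restrict_mem measurableSet_Ioi] with τ hmem
    rw [ENNReal.div_le_iff hc0 hc, mul_comm]
    exact hτ hmem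

theorem setLIntegral_rpow_le_of_setLIntegral_rpow_add_le {F : ℝ → ℝ≥0∞} {r σ b : ℝ} {A : ℝ≥0∞}
    (hr : 0 < r) (hσ : 0 ≤ σ)
    (h : ∫⁻ t in Ioi r, F t * ENNReal.ofReal (t ^ (σ + b)) ≤ A * ENNReal.ofReal (r ^ σ)) :
    ∫⁻ t in Ioi r, F t * ENNReal.ofReal (t ^ b) ≤ A := by
  have hrσ : ENNReal.ofReal (r ^ σ) ≠ 0 := by simpa using by positivity
  rw [← ENNReal.mul_le_mul_iff_left hrσ ofReal_ne_top]
  refine le_trans ?_ h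
  rw [← lintegral_mul_const' _ _ ofReal_ne_top]
  refine setLIntegral_mono' measurableSet_Ioi fun t ht => ?_
  have hrt : r < t := ht
  have ht0 : 0 < t := hr.trans hrt
  rw [Real.rpow_add ht0, ENNReal.ofReal_mul (by positivity), mul_assoc,
    mul_comm (ENNReal.ofReal (t ^ σ))]
  gcongr

/-- the Marcinkiewicz operator `μ_{Ω,α}` is bounded from the generalized
local Morrey space `LM_{p,φ₁}^{x₀}` to `LM_{q,φ₂}^{x₀}` under either Zygmund-type
condition (s' ≤ p with (316), or q < s with (317)). -/
theorem marcinkiewicz_local_Morrey_bounded {n : ℕ} (x₀ : EuclideanSpace ℝ (Fin n))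
    (α p q γ M : ℝ) (s : ℝ≥0∞) (Ω : EuclideanSpace ℝ (Fin n) → ℝ)
    (φ₁ φ₂ : EuclideanSpace ℝ (Fin n) → ℝ → ℝ)
    (hs1 : 1 < s) (hΩ : HomogZero Ω) (hΩs : MemLsSphere Ω s)
    (hΩ0 : ∫ z : sphere (0 : EuclideanSpace ℝ (Fin n)) 1,
      Ω (z : EuclideanSpace ℝ (Fin n))
        ∂((volume : Measure (EuclideanSpace ℝ (Fin n))).toSphere) = 0)
    (hγ : 0 < γ) (hγ1 : γ ≤ 1)
    (hΩLip : ∀ x y : sphere (0 : EuclideanSpace ℝ (Fin n)) 1,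
      |Ω (x : EuclideanSpace ℝ (Fin n)) - Ω (y : EuclideanSpace ℝ (Fin n))| ≤
        M * ‖(x : EuclideanSpace ℝ (Fin n)) - (y : EuclideanSpace ℝ (Fin n))‖ ^ γ)
    (hα : 0 < α) (hαn : α < n) (hp : 1 < p) (hpn : p < n / α)
    (hq : 1 / q = 1 / p - α / n)
    (hφ₁m : Measurable (Function.uncurry φ₁)) (hφ₂m : Measurable (Function.uncurry φ₂))
    (hφ₁ : ∀ (x : EuclideanSpace ℝ (Fin n)) (r : ℝ), 0 < r → 0 < φ₁ x r)
    (hφ₂ : ∀ (x : EuclideanSpace ℝ (Fin n)) (r : ℝ), 0 < r → 0 < φ₂ x r)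
    (hcond :
      (1 + 1 / (s - 1) ≤ ENNReal.ofReal p ∧
        ∃ C : ℝ, 0 < C ∧ ∀ r : ℝ, 0 < r →
          ∫⁻ t in Ioi r,
              essInf (fun τ => ENNReal.ofReal (φ₁ x₀ τ * τ ^ ((n : ℝ) / p)))
                  (volume.restrict (Ioi t)) *
                ENNReal.ofReal (t ^ (-(n : ℝ) / q - 1)) ≤
            ENNReal.ofReal (C * φ₂ x₀ r)) ∨
      (ENNReal.ofReal q < s ∧
        ∃ C : ℝ, 0 < C ∧ ∀ r : ℝ, 0 < r →
          ∫⁻ t in Ioi r,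
              essInf (fun τ => ENNReal.ofReal (φ₁ x₀ τ * τ ^ ((n : ℝ) / p)))
                  (volume.restrict (Ioi t)) *
                ENNReal.ofReal (t ^ (((n : ℝ≥0∞) / s).toReal - (n : ℝ) / q - 1)) ≤
            ENNReal.ofReal (C * φ₂ x₀ r * r ^ ((n : ℝ≥0∞) / s).toReal))) :
    ∃ C' : ℝ, 0 < C' ∧ ∀ f : EuclideanSpace ℝ (Fin n) → ℝ,
      AEStronglyMeasurable f volume →
        LMnormE q φ₂ x₀ (marcinkiewicz Ω f α) ≤ ENNReal.ofReal C' * LMnorm p φ₁ x₀ f := by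
  have hn : (0 : ℝ) < n := hα.trans hαn
  have hn' : 0 < n := by exact_mod_cast hn
  have : Nontrivial (EuclideanSpace ℝ (Fin n)) :=
    Module.nontrivial_of_finrank_pos (R := ℝ) (by simpa using hn')
  have hp0 : 0 < p := by linarith
  have hq0 : 0 < q := by
    rw [← one_div_pos, hq, sub_pos, div_lt_div_iff₀ hn hp0]
    rw [lt_div_iff₀ hα] at hpn
    linarith
  obtain ⟨C, hC, hzyg⟩ : ∃ C : ℝ, 0 < C ∧ ∀ r : ℝ, 0 < r →
      ∫⁻ t in Ioi r, essInf (fun τ => ENNReal.ofReal (φ₁ x₀ τ * τ ^ ((n : ℝ) / p)))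
          (volume.restrict (Ioi t)) * ENNReal.ofReal (t ^ (-(n : ℝ) / q - 1)) ≤
        ENNReal.ofReal (C * φ₂ x₀ r) := by
    rcases hcond with ⟨-, h⟩ | ⟨-, C, hC, h⟩
    · exact h
    · refine ⟨C, hC, fun r hr => setLIntegral_rpow_le_of_setLIntegral_rpow_add_le hr
        (toReal_nonneg (a := (n : ℝ≥0∞) / s)) ?_⟩
      rw [← ENNReal.ofReal_mul (mul_pos hC (hφ₂ x₀ r hr)).le]
      convert h r hr using 6
      ring
  obtain ⟨K, -, hK⟩ := hΩ.exists_abs_le hγ hΩLip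
  obtain ⟨D, hD, hloc⟩ := exists_setLIntegral_ball_rieszPotential_rpow_le
    (volume : Measure (EuclideanSpace ℝ (Fin n))) hp hα hq0 (by simpa using hq)
  set L : ℝ≥0∞ := ENNReal.ofReal K * ENNReal.ofReal ((n - α) * 2 ^ (n - α)) with hL
  have hLt : L ≠ ⊤ := by finiteness
  set v : ℝ≥0∞ := volume (ball (0 : EuclideanSpace ℝ (Fin n)) 1) ^ (1 / p)
  have hv : v ≠ ⊤ := ENNReal.rpow_ne_top_of_nonneg (by positivity) measure_ball_lt_top.ne
  set G : ℝ≥0∞ := L * D * v * ENNReal.ofReal C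
  have hG : G ≠ ⊤ := by finiteness
  refine ⟨G.toReal + 1, by positivity, fun f hf => ?_⟩
  rcases eq_or_ne (LMnorm p φ₁ x₀ f) ⊤ with hA | hA
  · rw [hA, ENNReal.mul_top (by simpa using by positivity)]
    exact le_top
  have hGle : G ≤ ENNReal.ofReal (G.toReal + 1) := by
    rw [ENNReal.le_ofReal_iff_toReal_le hG (by positivity)]
    linarith
  set g := hf.enorm.mk _
  have hg : Measurable g := hf.enorm.measurable_mk
  have hfg : (fun y => ‖f y‖ₑ) =ᵐ[volume] g := hf.enorm.ae_eq_mk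
  have hLpB (t : ℝ) : (∫⁻ y in ball x₀ t, g y ^ p) ^ (1 / p) = LpB p f x₀ t := by
    rw [LpB, eLpNorm_eq_lintegral_rpow_enorm_toReal (by simpa using hp0) ofReal_ne_top,
      ENNReal.toReal_ofReal hp0.le]
    congr 1
    refine lintegral_congr_ae (ae_restrict_of_ae ?_)
    filter_upwards [hfg] with y hy
    rw [hy]
  refine iSup_le fun ⟨r, hr⟩ => ?_
  dsimp only
  set V := volume (ball x₀ r) ^ (1 / q) with hV
  have hV0 : V ≠ 0 := (ENNReal.rpow_pos (measure_ball_pos volume x₀ hr) measure_ball_lt_top.ne).ne'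
  have hVt : V ≠ ⊤ := ENNReal.rpow_ne_top_of_nonneg (by positivity) measure_ball_lt_top.ne
  have hφ0 : ENNReal.ofReal (φ₂ x₀ r) ≠ 0 := by simpa using hφ₂ x₀ r hr
  have hT : ∫⁻ t in Ioi (2 * r), ENNReal.ofReal (t ^ (-(n : ℝ) / q - 1)) *
      (∫⁻ y in ball x₀ t, g y ^ p) ^ (1 / p) ≤
        LMnorm p φ₁ x₀ f * v * ENNReal.ofReal (C * φ₂ x₀ r) := by
    refine le_trans ?_ (mul_le_mul_right (hzyg r hr) _)
    rw [← lintegral_const_mul' _ _ (ENNReal.mul_ne_top hA hv)]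
    refine (setLIntegral_mono' measurableSet_Ioi fun t ht => ?_).trans
      (lintegral_mono_set (Ioi_subset_Ioi (by linarith : r ≤ 2 * r)))
    have ht0 : 0 < t := lt_trans (by positivity) (mem_Ioi.1 ht)
    rw [hLpB, mul_comm, ← mul_assoc]
    gcongr
    exact LpB_le_LMnorm_mul_essInf hp0 x₀ (hφ₁ x₀) f hA ht0
  have hmain : LpBE q (marcinkiewicz Ω f α) x₀ r ≤
      L * (D * V * (LMnorm p φ₁ x₀ f * v * ENNReal.ofReal (C * φ₂ x₀ r))) := by
    calc LpBE q (marcinkiewicz Ω f α) x₀ r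
        ≤ (∫⁻ x in ball x₀ r, L ^ q * rieszPotential volume α g x ^ q) ^ (1 / q) := by
          unfold LpBE
          gcongr with x
          rw [← ENNReal.mul_rpow_of_nonneg _ _ hq0.le]
          gcongr
          exact marcinkiewicz_le_rieszPotential hK hg hfg hαn x
      _ = L * (∫⁻ x in ball x₀ r, rieszPotential volume α g x ^ q) ^ (1 / q) := by
          rw [lintegral_const_mul' _ _ (ENNReal.rpow_ne_top_of_nonneg hq0.le hLt),
            ENNReal.mul_rpow_of_nonneg _ _ (by positivity), ← ENNReal.rpow_mul,
            mul_one_div_cancel hq0.ne', ENNReal.rpow_one]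
      _ ≤ _ := by
          gcongr
          refine (hloc g hg x₀ r hr).trans ?_
          rw [finrank_euclideanSpace_fin]
          gcongr
  calc (ENNReal.ofReal (φ₂ x₀ r))⁻¹ * volume (ball x₀ r) ^ (-(1 / q)) *
        LpBE q (marcinkiewicz Ω f α) x₀ r
      ≤ (ENNReal.ofReal (φ₂ x₀ r))⁻¹ * V⁻¹ *
          (L * (D * V * (LMnorm p φ₁ x₀ f * v * ENNReal.ofReal (C * φ₂ x₀ r)))) := by
        rw [ENNReal.rpow_neg]
        gcongr
    _ = (ENNReal.ofReal (φ₂ x₀ r))⁻¹ * ENNReal.ofReal (φ₂ x₀ r) * (V⁻¹ * V) *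
          (G * LMnorm p φ₁ x₀ f) := by
        rw [ENNReal.ofReal_mul hC.le]
        ring
    _ = G * LMnorm p φ₁ x₀ f := by
        rw [ENNReal.inv_mul_cancel hφ0 ofReal_ne_top, ENNReal.inv_mul_cancel hV0 hVt, one_mul,
          one_mul]
    _ ≤ _ := by gcongr

end
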